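/- Let C ⊆ 𝒜^s/K have induced minimum homogeneous distance d, ℓ = |supp(K)|. If γℓ ≤ r ≤ γs and (r−γℓ)² − γ(s−ℓ)(2r − d − γℓ) > 0, then |C| ≤ h(r,s,ℓ,d)·|𝒜|^{s−ℓ} / |B^{s−ℓ}(r − γℓ)|, where h(r,s,ℓ,d) = (d−γℓ)γ(s−ℓ) / ((r−γℓ)² − γ(s−ℓ)(2r−d−γℓ)). -/

import Mathlib

open Finset MulOpposite
open scoped Classical BigOperators

lemma w_real {R A : Type*} [Ring R] [Fintype R] [DecidableEq R]
    [AddCommGroup A] [Module Rᵐᵒᵖ A]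
    (χ : AddChar A ℂ) (γ : ℝ) (w : A → ℝ)
    (hw : ∀ a : A, (w a : ℂ) =
      (γ : ℂ) * (1 - (Fintype.card Rˣ : ℂ)⁻¹ * ∑ u : Rˣ, χ (op (u : R) • a))) (a : A) :
    w a = γ * (1 - (Fintype.card Rˣ : ℝ)⁻¹ * ∑ u : Rˣ, (χ (op (u : R) • a)).re) := by
  have h := congrArg Complex.re (hw a)
  have e : ((Fintype.card Rˣ : ℂ)⁻¹) = (((Fintype.card Rˣ : ℝ)⁻¹ : ℝ) : ℂ) := by push_cast; rfl
  rw [e, Complex.ofReal_re, Complex.re_ofReal_mul, Complex.sub_re, Complex.re_ofReal_mul,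
    Complex.re_sum] at h
  simpa using h

lemma pair_sum {R A ι : Type*} [Ring R] [Fintype R] [DecidableEq R]
    [AddCommGroup A] [Module Rᵐᵒᵖ A] [Fintype A]
    (χ : AddChar A ℂ) (γ : ℝ) (hγ : 0 < γ) (w : A → ℝ)
    (hw : ∀ a : A, (w a : ℂ) =
      (γ : ℂ) * (1 - (Fintype.card Rˣ : ℂ)⁻¹ * ∑ u : Rˣ, χ (op (u : R) • a)))
    (D : Finset ι) (g : ι → A) :
    ∑ c ∈ D, ∑ c' ∈ D, w (g c - g c') ≤
      2 * D.card * (∑ c ∈ D, w (g c)) - (∑ c ∈ D, w (g c)) ^ 2 / γ := by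
  have hr := w_real χ γ w hw
  set N : ℝ := (Fintype.card Rˣ : ℝ) with hN
  have hNpos : 0 < N := by
    rw [hN]; exact_mod_cast Fintype.card_pos
  let F : Rˣ → ℂ := fun u => ∑ c ∈ D, χ (op (u : R) • g c)
  have h1 : ∑ c ∈ D, ∑ c' ∈ D, w (g c - g c') =
      γ * ((D.card : ℝ) ^ 2 - N⁻¹ * ∑ u, Complex.normSq (F u)) := by
    have hF : ∀ u, Complex.normSq (F u) =
        ∑ c ∈ D, ∑ c' ∈ D, (χ (op (u : R) • (g c - g c'))).re := by
      intro u
      have : (Complex.normSq (F u) : ℂ) =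
          ∑ c ∈ D, ∑ c' ∈ D, (χ (op (u : R) • (g c - g c'))) := by
        rw [← Complex.mul_conj]
        simp only [F]
        rw [map_sum, Finset.sum_mul_sum]
        refine Finset.sum_congr rfl fun c _ => Finset.sum_congr rfl fun c' _ => ?_
        rw [smul_sub, sub_eq_add_neg, AddChar.map_add_eq_mul, AddChar.map_neg_eq_conj]
      have := congrArg Complex.re this
      simpa using this
    simp only [hr, hF]
    simp only [mul_sub, Finset.sum_sub_distrib, ← Finset.mul_sum]
    congr 1
    · simp only [Finset.sum_const, nsmul_eq_mul]; ring
    · congr 2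
      rw [Finset.sum_comm]
      symm
      rw [Finset.sum_comm]
      rw [Finset.sum_comm]
      have : ∀ c ∈ D, ∑ c' ∈ D, ∑ u : Rˣ, (χ (op (u : R) • g c - op (u : R) • g c')).re =
        ∑ u : Rˣ, ∑ c' ∈ D, (χ (op (u : R) • g c - op (u : R) • g c')).re :=
        fun c _ => Finset.sum_comm
      simp only [smul_sub]
      first
      | rw [Finset.sum_comm, Finset.sum_congr rfl this, Finset.sum_comm]
      | (rw [Finset.sum_comm]
         symm
         rw [Finset.sum_comm, Finset.sum_congr rfl this, Finset.sum_comm])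
  have h2 : ∑ c ∈ D, w (g c) = γ * ((D.card : ℝ) - N⁻¹ * ∑ u, (F u).re) := by
    simp only [hr, F, Complex.re_sum]
    simp only [mul_sub, Finset.sum_sub_distrib, ← Finset.mul_sum]
    congr 1
    · simp only [Finset.sum_const, nsmul_eq_mul]; ring
    · rw [Finset.sum_comm]
  have h3 : (N⁻¹ * ∑ u, (F u).re) ^ 2 ≤ N⁻¹ * ∑ u, Complex.normSq (F u) := by
    have a1 : (∑ u, (F u).re) ^ 2 ≤ N * ∑ u, (F u).re ^ 2 := by
      have := sq_sum_le_card_mul_sum_sq (s := (univ : Finset Rˣ)) (f := fun u => (F u).re)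
      simpa [hN] using this
    have a2 : ∑ u, (F u).re ^ 2 ≤ ∑ u, Complex.normSq (F u) := by
      refine Finset.sum_le_sum fun u _ => ?_
      rw [Complex.normSq_apply]; nlinarith [sq_nonneg (F u).im]
    rw [mul_pow]
    calc N⁻¹ ^ 2 * (∑ u, (F u).re) ^ 2 ≤ N⁻¹ ^ 2 * (N * ∑ u, Complex.normSq (F u)) := by
          gcongr; exact a1.trans (by gcongr)
      _ = _ := by field_simp
  rw [h1, h2]
  set P := N⁻¹ * ∑ u, (F u).re
  set Q := N⁻¹ * ∑ u, Complex.normSq (F u)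
  have : 2 * (D.card : ℝ) * (γ * (D.card - P)) - (γ * (D.card - P)) ^ 2 / γ
      = γ * ((D.card : ℝ) ^ 2 - P ^ 2) := by field_simp; ring
  rw [this]
  gcongr

lemma anticode {R A ι : Type*} [Ring R] [Fintype R] [DecidableEq R]
    [AddCommGroup A] [Module Rᵐᵒᵖ A] [Fintype A]
    (χ : AddChar A ℂ) (γ : ℝ) (hγ : 0 < γ) (w : A → ℝ)
    (hw : ∀ a : A, (w a : ℂ) =
      (γ : ℂ) * (1 - (Fintype.card Rˣ : ℂ)⁻¹ * ∑ u : Rˣ, χ (op (u : R) • a)))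
    (n : ℕ) (hn : 0 < n) (D : Finset ι) (g : ι → Fin n → A) (ρ δ : ℝ)
    (hρ : ρ ≤ γ * n)
    (hB : ∀ c ∈ D, ∑ i, w (g c i) ≤ ρ)
    (hδ : ∀ c ∈ D, ∀ c' ∈ D, c ≠ c' → δ ≤ ∑ i, w (g c i - g c' i)) (hδ0 : 0 < δ)
    (hpos : 0 < ρ ^ 2 - γ * n * (2 * ρ - δ)) :
    (D.card : ℝ) ≤ δ * γ * n / (ρ ^ 2 - γ * n * (2 * ρ - δ)) := by
  rw [le_div_iff₀ hpos]
  have hn' : (0 : ℝ) < n := by exact_mod_cast hn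
  set M : ℝ := (D.card : ℝ) with hM
  rcases D.eq_empty_or_nonempty with h0 | h0
  · have : M = 0 := by rw [hM, h0]; simp
    rw [this, zero_mul]; positivity
  have hM0 : 0 < M := by rw [hM]; exact_mod_cast h0.card_pos
  have w0 : w 0 = 0 := by
    have := w_real χ γ w hw 0
    rw [this]; simp
  let W : Fin n → ℝ := fun i => ∑ c ∈ D, w (g c i)
  have lower : M * (M - 1) * δ ≤ ∑ c ∈ D, ∑ c' ∈ D, ∑ i, w (g c i - g c' i) := by
    have : ∀ c ∈ D, (M - 1) * δ ≤ ∑ c' ∈ D, ∑ i, w (g c i - g c' i) := by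
      intro c hc
      rw [← Finset.add_sum_erase D _ hc]
      simp only [sub_self, w0, Finset.sum_const_zero, zero_add]
      have := Finset.card_nsmul_le_sum (D.erase c) (fun c' => ∑ i, w (g c i - g c' i)) δ
        (fun c' hc' => hδ c hc c' (Finset.mem_of_mem_erase hc') (Finset.ne_of_mem_erase hc').symm)
      rw [Finset.card_erase_of_mem hc, nsmul_eq_mul, Nat.cast_sub h0.card_pos] at this
      simpa [hM] using this
    have := Finset.card_nsmul_le_sum D _ _ this
    rw [nsmul_eq_mul, ← hM] at this
    linarith
  have upper : ∑ c ∈ D, ∑ c' ∈ D, ∑ i, w (g c i - g c' i) ≤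
      2 * M * (∑ i, W i) - (∑ i, W i) ^ 2 / (γ * n) := by
    have e : ∑ c ∈ D, ∑ c' ∈ D, ∑ i, w (g c i - g c' i) =
        ∑ i, ∑ c ∈ D, ∑ c' ∈ D, w (g c i - g c' i) := by
      rw [Finset.sum_comm (s := univ)]
      exact Finset.sum_congr rfl fun c _ => Finset.sum_comm
    rw [e]
    have s1 : ∑ i, ∑ c ∈ D, ∑ c' ∈ D, w (g c i - g c' i) ≤ ∑ i, (2 * M * W i - W i ^ 2 / γ) :=
      Finset.sum_le_sum fun i _ => pair_sum χ γ hγ w hw D (fun c => g c i)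
    refine s1.trans ?_
    rw [Finset.sum_sub_distrib, ← Finset.mul_sum, ← Finset.sum_div]
    have s2 : (∑ i, W i) ^ 2 ≤ n * ∑ i, W i ^ 2 := by
      have := sq_sum_le_card_mul_sum_sq (s := (univ : Finset (Fin n))) (f := W)
      simpa using this
    have : (∑ i, W i) ^ 2 / (γ * n) ≤ (∑ i, W i ^ 2) / γ := by
      rw [div_le_div_iff₀ (by positivity) hγ]
      nlinarith
    linarith
  have hW : ∑ i, W i ≤ M * ρ := by
    simp only [W]
    rw [Finset.sum_comm]
    have := Finset.sum_le_card_nsmul D _ _ hB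
    simpa [hM] using this
  set V := ∑ i, W i
  have hG : 0 < γ * n := by positivity
  set G := γ * (n : ℝ) with hGd
  have mono : 2 * M * V - V ^ 2 / G ≤ M ^ 2 * (2 * ρ - ρ ^ 2 / G) := by
    have : M ^ 2 * (2 * ρ - ρ ^ 2 / G) - (2 * M * V - V ^ 2 / G) =
      (M * ρ - V) * ((M * G - M * ρ) + (M * G - V)) / G := by field_simp; ring
    have h1 : 0 ≤ M * G - M * ρ := by nlinarith
    have : 0 ≤ (M * ρ - V) * ((M * G - M * ρ) + (M * G - V)) / G := by
      apply div_nonneg _ hG.le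
      apply mul_nonneg <;> linarith
    linarith
  have fin : M * ((M - 1) * δ) ≤ M * (M * (2 * ρ - ρ ^ 2 / G)) := by nlinarith
  have fin2 := le_of_mul_le_mul_left fin hM0
  have fin3 : (M - 1) * δ * G ≤ M * (2 * ρ - ρ ^ 2 / G) * G := by gcongr
  have : M * (2 * ρ - ρ ^ 2 / G) * G = M * (2 * ρ * G - ρ ^ 2) := by field_simp
  rw [this] at fin3
  rw [mul_assoc δ, ← hGd]
  nlinarith

lemma coset_zero {R A : Type*} [Ring R] [Fintype R] [DecidableEq R]
    [AddCommGroup A] [Module R A] [Module Rᵐᵒᵖ A] [SMulCommClass R Rᵐᵒᵖ A] [Fintype A]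
    (χ : AddChar A ℂ)
    (hgenL : ∀ N : Submodule R A, (∀ x ∈ N, χ x = 1) → N = ⊥)
    (s : ℕ) (K : Submodule R (Fin s → A)) (i : Fin s) (hi : ∃ z ∈ K, z i ≠ 0)
    (u : Rˣ) : ∑ k : K, χ (op (u : R) • (k : Fin s → A) i) = 0 := by
  have : ∃ k0 : K, χ (op (u : R) • (k0 : Fin s → A) i) ≠ 1 := by
    by_contra! hcon
    let L : (Fin s → A) →ₗ[R] A :=
      { toFun := fun z => op (u : R) • z i
        map_add' := fun x y => by simp
        map_smul' := fun r x => by simp [smul_comm] }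
    have hbot := hgenL (K.map L) (by
      rintro x ⟨z, hz, rfl⟩
      exact hcon ⟨z, hz⟩)
    obtain ⟨z, hz, hz0⟩ := hi
    have : L z ∈ K.map L := Submodule.mem_map_of_mem hz
    rw [hbot, Submodule.mem_bot] at this
    apply hz0
    have h2 : op ((u⁻¹ : Rˣ) : R) • (op (u : R) • z i) = 0 := by
      change op (u : R) • z i = 0 at this
      rw [this, smul_zero]
    rw [smul_smul, ← op_mul, Units.mul_inv, op_one, one_smul] at h2
    exact h2
  obtain ⟨k0, hk0⟩ := this
  have e : ∑ k : K, χ (op (u : R) • (k : Fin s → A) i) =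
      χ (op (u : R) • (k0 : Fin s → A) i) * ∑ k : K, χ (op (u : R) • (k : Fin s → A) i) := by
    rw [Finset.mul_sum, ← Fintype.sum_equiv (Equiv.addLeft k0) _ _ (fun _ => rfl)]
    refine Finset.sum_congr rfl fun k _ => ?_
    simp [smul_add, AddChar.map_add_eq_mul]
  by_contra hne
  exact hk0 (mul_right_cancel₀ hne (by rw [one_mul]; exact e.symm))

lemma coset_avg {R A : Type*} [Ring R] [Fintype R] [DecidableEq R]
    [AddCommGroup A] [Module R A] [Module Rᵐᵒᵖ A] [SMulCommClass R Rᵐᵒᵖ A] [Fintype A]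
    (χ : AddChar A ℂ)
    (hgenL : ∀ N : Submodule R A, (∀ x ∈ N, χ x = 1) → N = ⊥)
    (γ : ℝ) (w : A → ℝ)
    (hw : ∀ a : A, (w a : ℂ) =
      (γ : ℂ) * (1 - (Fintype.card Rˣ : ℂ)⁻¹ * ∑ u : Rˣ, χ (op (u : R) • a)))
    (s : ℕ) (K : Submodule R (Fin s → A)) (i : Fin s) (hi : ∃ z ∈ K, z i ≠ 0)
    (a : A) : ∑ k : K, w (a + (k : Fin s → A) i) = Fintype.card K * γ := by
  have : ((∑ k : K, w (a + (k : Fin s → A) i) : ℝ) : ℂ) = ((Fintype.card K * γ : ℝ) : ℂ) := by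
    push_cast
    simp only [hw]
    rw [← Finset.mul_sum, Finset.sum_sub_distrib, ← Finset.mul_sum, Finset.sum_comm]
    have : ∀ u : Rˣ, ∑ k : K, χ (op (u : R) • (a + (k : Fin s → A) i)) = 0 := by
      intro u
      simp only [smul_add, AddChar.map_add_eq_mul]
      rw [← Finset.mul_sum, coset_zero χ hgenL s K i hi u, mul_zero]
    rw [Finset.sum_congr rfl (fun u _ => this u)]
    simp [mul_comm]
  exact_mod_cast this

lemma coset_bound {R A : Type*} [Ring R] [Fintype R] [DecidableEq R]
    [AddCommGroup A] [Module R A] [Module Rᵐᵒᵖ A] [SMulCommClass R Rᵐᵒᵖ A] [Fintype A]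
    (χ : AddChar A ℂ)
    (hgenL : ∀ N : Submodule R A, (∀ x ∈ N, χ x = 1) → N = ⊥)
    (γ : ℝ) (w : A → ℝ)
    (hw : ∀ a : A, (w a : ℂ) =
      (γ : ℂ) * (1 - (Fintype.card Rˣ : ℂ)⁻¹ * ∑ u : Rˣ, χ (op (u : R) • a)))
    (s : ℕ) (K : Submodule R (Fin s → A)) (z : Fin s → A) (d : ℝ)
    (h : ∀ k ∈ K, d ≤ ∑ i, w ((z + k) i)) :
    d ≤ γ * (univ.filter fun i : Fin s => ∃ z ∈ K, z i ≠ 0).card +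
      ∑ i ∈ univ.filter (fun i : Fin s => ¬ ∃ z ∈ K, z i ≠ 0), w (z i) := by
  have h1 := Finset.card_nsmul_le_sum (univ : Finset K)
    (fun k => ∑ i, w (z i + (k : Fin s → A) i)) d (fun k _ => h k k.2)
  rw [Finset.sum_comm, ← Finset.sum_filter_add_sum_filter_not univ
    (fun i : Fin s => ∃ z ∈ K, z i ≠ 0)] at h1
  rw [Finset.sum_congr (g := fun _ => (Fintype.card K : ℝ) * γ) rfl (fun i hi =>
    coset_avg χ hgenL γ w hw s K i (Finset.mem_filter.1 hi).2 (z i))] at h1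
  rw [Finset.sum_congr (s₁ := univ.filter (fun i : Fin s => ¬ ∃ z ∈ K, z i ≠ 0))
    (g := fun i => (Fintype.card K : ℝ) * w (z i)) rfl (fun i hi => by
      have hi := (Finset.mem_filter.1 hi).2
      push Not at hi
      rw [Finset.sum_congr (g := fun _ => w (z i)) rfl (fun k _ => by
        rw [hi k k.2, add_zero])]
      simp)] at h1
  rw [← Finset.mul_sum, Finset.sum_const, nsmul_eq_mul, nsmul_eq_mul, Finset.card_univ] at h1
  have hK : (0 : ℝ) < Fintype.card K := by exact_mod_cast Fintype.card_pos
  refine le_of_mul_le_mul_left ?_ hK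
  rw [← Finset.mul_sum] at h1
  linarith

lemma double_count {X G : Type*} [AddCommGroup G] [Fintype G] (C : Finset X) (f : X → G)
    (B : Finset G) :
    ∑ x : G, (C.filter fun c => f c - x ∈ B).card = C.card * B.card := by
  simp only [Finset.card_filter _ C]
  rw [Finset.sum_comm]
  have : ∀ c ∈ C, ∑ x : G, (if f c - x ∈ B then 1 else 0) = B.card := by
    intro c _
    rw [Fintype.sum_equiv (Equiv.subLeft (f c)) (fun x => if f c - x ∈ B then 1 else 0)
      (fun y => if y ∈ B then 1 else 0) (fun _ => by simp)]
    simp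
  rw [Finset.sum_congr rfl this]
  simp

/-- Elias–Bassalygo bound for codes in quotient modules. If
`γℓ ≤ r ≤ γs` and `(r−γℓ)² − γ(s−ℓ)(2r − d − γℓ) > 0` then
`|C| ≤ h(r,s,ℓ,d)·|𝒜|^{s−ℓ}/|B^{s−ℓ}(r−γℓ)|` with
`h(r,s,ℓ,d) = (d−γℓ)γ(s−ℓ)/((r−γℓ)² − γ(s−ℓ)(2r−d−γℓ))`. -/
theorem stmt17 {R A : Type*} [Ring R] [Fintype R] [DecidableEq R]
    [AddCommGroup A] [Module R A] [Module Rᵐᵒᵖ A] [SMulCommClass R Rᵐᵒᵖ A] [Fintype A]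
    (χ : AddChar A ℂ)
    (hgenL : ∀ N : Submodule R A, (∀ x ∈ N, χ x = 1) → N = ⊥)
    (hgenR : ∀ N : Submodule Rᵐᵒᵖ A, (∀ x ∈ N, χ x = 1) → N = ⊥)
    (hcard : Fintype.card A = Fintype.card R)
    (γ : ℝ) (w : A → ℝ)
    (hw : ∀ a : A, (w a : ℂ) =
      (γ : ℂ) * (1 - (Fintype.card Rˣ : ℂ)⁻¹ * ∑ u : Rˣ, χ (op (u : R) • a)))
    (s ℓ : ℕ) (K : Submodule R (Fin s → A))
    (hKright : ∀ (r : R), ∀ z ∈ K, (op r • z : Fin s → A) ∈ K)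
    (hℓ : (univ.filter fun i : Fin s => ∃ z ∈ K, z i ≠ 0).card = ℓ)
    (C : Finset ((Fin s → A) ⧸ K))
    (d : ℝ)
    (hd_le : ∀ c ∈ C, ∀ c' ∈ C, c ≠ c' → ∀ z : Fin s → A,
      (Submodule.Quotient.mk z : (Fin s → A) ⧸ K) = c - c' → d ≤ ∑ i, w (z i))
    (hd_ex : ∃ c ∈ C, ∃ c' ∈ C, c ≠ c' ∧ ∃ z : Fin s → A,
      (Submodule.Quotient.mk z : (Fin s → A) ⧸ K) = c - c' ∧ ∑ i, w (z i) = d)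
    (r : ℝ) (hrl : γ * ℓ ≤ r) (hru : r ≤ γ * s)
    (hpos : 0 < (r - γ * ℓ) ^ 2 - γ * ((s : ℝ) - ℓ) * (2 * r - d - γ * ℓ)) :
    (C.card : ℝ) ≤
      ((d - γ * ℓ) * γ * ((s : ℝ) - ℓ) /
          ((r - γ * ℓ) ^ 2 - γ * ((s : ℝ) - ℓ) * (2 * r - d - γ * ℓ))) *
        (Fintype.card A : ℝ) ^ (s - ℓ) /
          (Nat.card {z : Fin (s - ℓ) → A // ∑ i, w (z i) ≤ r - γ * ℓ} : ℝ) := by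
  have hℓs : ℓ ≤ s := by
    rw [← hℓ]; simpa using Finset.card_filter_le (univ : Finset (Fin s)) _
  have hℓs' : ℓ ≠ s := by
    rintro rfl
    have : r = γ * ℓ := le_antisymm hru hrl
    rw [this] at hpos; simp at hpos
  have hlt : ℓ < s := lt_of_le_of_ne hℓs hℓs'
  obtain ⟨n, rfl⟩ := Nat.exists_eq_add_of_lt hlt
  obtain ⟨m, hm⟩ : ∃ m, m = n + 1 := ⟨_, rfl⟩
  have hsub : ℓ + n + 1 - ℓ = m := by omega
  have hcast : ((ℓ + n + 1 : ℕ) : ℝ) - ℓ = m := by rw [hm]; push_cast; ring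
  have hm0 : 0 < m := by omega
  rw [hsub]
  rw [hcast] at hpos ⊢
  generalize hs : ℓ + n + 1 = s at *
  have hm0' : (0 : ℝ) < m := by exact_mod_cast hm0
  obtain ⟨ρ, hρ⟩ : ∃ ρ, ρ = r - γ * ℓ := ⟨_, rfl⟩
  obtain ⟨δ, hδ⟩ : ∃ δ, δ = d - γ * ℓ := ⟨_, rfl⟩
  have hx : 2 * r - d - γ * ℓ = 2 * ρ - δ := by rw [hρ, hδ]; ring
  rw [hx] at hpos ⊢
  rw [← hρ] at hpos ⊢
  rw [← hδ]
  have hρ0 : 0 ≤ ρ := by linarith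
  have hρm : ρ ≤ γ * m := by
    rw [← hcast, hρ]; linarith
  have hγ : 0 < γ := by
    rcases lt_trichotomy γ 0 with h | h | h
    · nlinarith
    · rw [h] at hρm hpos
      have : ρ = 0 := by linarith
      rw [this] at hpos; simp at hpos
    · exact h
  have hδ0 : 0 < δ := by
    by_contra! hcon
    have : 0 < γ * m := by positivity
    nlinarith
  -- the coordinates outside the support
  have hcardT : Fintype.card {i : Fin s // ¬ ∃ z ∈ K, z i ≠ 0} = m := by
    rw [Fintype.card_subtype_compl, Fintype.card_subtype, hℓ, Fintype.card_fin]; exact hsub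
  let e : Fin m ≃ {i : Fin s // ¬ ∃ z ∈ K, z i ≠ 0} := (Fintype.equivFinOfCardEq hcardT).symm
  obtain ⟨q, hq⟩ : ∃ q : ((Fin s → A) ⧸ K) → (Fin s → A),
      ∀ c, (Submodule.Quotient.mk (q c) : (Fin s → A) ⧸ K) = c :=
    ⟨fun c => Quotient.out c, fun c => Quotient.out_eq' c⟩
  let f : ((Fin s → A) ⧸ K) → Fin m → A := fun c j => q c (e j)
  have hf : ∀ c ∈ C, ∀ c' ∈ C, c ≠ c' → δ ≤ ∑ j, w (f c j - f c' j) := by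
    intro c hc c' hc' hne
    have hk : ∀ k ∈ K, d ≤ ∑ i, w ((q c - q c' + k) i) := by
      intro k hk
      apply hd_le c hc c' hc' hne
      rw [Submodule.Quotient.mk_add, Submodule.Quotient.mk_sub, hq, hq,
          (Submodule.Quotient.mk_eq_zero K).2 hk, add_zero]
    have hb := coset_bound χ hgenL γ w hw s K (q c - q c') d hk
    rw [hℓ] at hb
    have e1 : ∑ j, w (f c j - f c' j) =
        ∑ i ∈ univ.filter (fun i : Fin s => ¬ ∃ z ∈ K, z i ≠ 0), w ((q c - q c') i) := by
      rw [Finset.sum_subtype (p := fun i : Fin s => ¬ ∃ z ∈ K, z i ≠ 0) _ (fun i => by simp)]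
      rw [← e.sum_comp]
      rfl
    rw [e1]; linarith
  -- averaging
  let B : Finset (Fin m → A) := univ.filter fun z => ∑ i, w (z i) ≤ ρ
  have hBc : Nat.card {z : Fin m → A // ∑ i, w (z i) ≤ ρ} = B.card := by
    rw [Nat.card_eq_fintype_card, Fintype.card_subtype]
  rw [hBc]
  have w0 : w 0 = 0 := by
    have := w_real χ γ w hw 0
    rw [this]; simp
  have hB0 : (0 : ℝ) < B.card := by
    have : B.Nonempty := ⟨0, by simp [B, w0, hρ0]⟩
    exact_mod_cast this.card_pos
  rw [le_div_iff₀ hB0]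
  have hx1 : ∀ x : Fin m → A, ((C.filter fun c => f c - x ∈ B).card : ℝ) ≤
      δ * γ * m / (ρ ^ 2 - γ * m * (2 * ρ - δ)) := by
    intro x
    refine anticode χ γ hγ w hw m hm0 _ (fun c => f c - x) ρ δ hρm ?_ ?_ hδ0 hpos
    · intro c hc
      exact (Finset.mem_filter.1 (Finset.mem_filter.1 hc).2).2
    · intro c hc c' hc' hne
      have := hf c (Finset.mem_filter.1 hc).1 c' (Finset.mem_filter.1 hc').1 hne
      simpa using this
  have hdc : ∑ x : Fin m → A, (C.filter fun c => f c - x ∈ B).card = C.card * B.card := by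
    rw [← double_count C f B]
    refine Finset.sum_congr rfl fun x _ => ?_
    congr!
  have hsum := Finset.sum_le_card_nsmul (univ : Finset (Fin m → A)) _ _ (fun x _ => hx1 x)
  rw [← Nat.cast_sum, hdc, nsmul_eq_mul, Finset.card_univ, Fintype.card_fun,
    Fintype.card_fin] at hsum
  push_cast at hsum
  linarith
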